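/- Let D be a self-adjoint operator and H a bounded self-adjoint operator preserving Dom(D) with [D,H] bounded. Then for every Schwartz-class (or compactly supported smooth) function f : ℝ → ℝ, f(H) preserves Dom(D) and ‖[D, f(H)]‖ ≤ (2π)^{−1} ‖(ℱ f′)‖_{L¹(ℝ)} ‖[D,H]‖, where ℱ denotes the Fourier transform. -/

import Mathlib

local notation "⟪" x ", " y "⟫" => @inner ℂ _ _ x y

open MeasureTheory

open Filter Topology CompactlySupported

theorem Real.measure_eq_zero_of_closedBall_le_sq (μ : Measure ℝ) {A : Set ℝ} {K : ℝ}
    (hA : ∀ a ∈ A, ∀ r : ℝ, 0 < r → μ (Metric.closedBall a r) ≤ ENNReal.ofReal (K * r ^ 2)) :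
    μ A = 0 := by
  have hcover : A = ⋃ k : ℤ, A ∩ Set.Ico (k : ℝ) (k + 1) := by
    rw [← Set.inter_iUnion, iUnion_Ico_intCast, Set.inter_univ]
  rw [hcover, measure_iUnion_null_iff]
  intro k
  have hbound (m : ℕ) :
      μ (A ∩ Set.Ico (k : ℝ) (k + 1)) ≤ ENNReal.ofReal (K / ((m : ℝ) + 1)) := by
    have hm : (0 : ℝ) < m + 1 := by positivity
    let J (j : ℕ) : Set ℝ := A ∩ Set.Icc (k + j / ((m : ℝ) + 1)) (k + (j + 1) / ((m : ℝ) + 1))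
    have hsub : A ∩ Set.Ico (k : ℝ) (k + 1) ⊆ ⋃ j ∈ Finset.range (m + 1), J j := by
      rintro x ⟨hxA, hx0, hx1⟩
      have h0 : 0 ≤ (x - k) * (m + 1) := mul_nonneg (by linarith) hm.le
      simp only [Set.mem_iUnion, Finset.mem_range]
      refine ⟨⌊(x - k) * (m + 1)⌋₊, ?_, hxA, ?_, ?_⟩
      · rw [Nat.floor_lt h0]; push_cast; nlinarith
      · have := Nat.floor_le h0
        rw [← le_sub_iff_add_le', div_le_iff₀ hm]; exact this
      · have := (Nat.lt_floor_add_one ((x - k) * ((m : ℝ) + 1))).le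
        rw [← sub_le_iff_le_add', le_div_iff₀ hm]; exact this
    have hJ (j : ℕ) : μ (J j) ≤ ENNReal.ofReal (K * (1 / ((m : ℝ) + 1)) ^ 2) := by
      rcases (J j).eq_empty_or_nonempty with he | ⟨a, ha⟩
      · simp [he]
      · refine (measure_mono ?_).trans (hA a ha.1 _ (by positivity))
        rintro x ⟨-, hx⟩
        have ha2 := ha.2
        rw [Set.mem_Icc, add_div] at hx ha2
        rw [Metric.mem_closedBall, Real.dist_eq, abs_le]
        constructor <;> linarith [hx.1, hx.2, ha2.1, ha2.2]
    calc μ (A ∩ Set.Ico (k : ℝ) (k + 1)) ≤ ∑ j ∈ Finset.range (m + 1), μ (J j) :=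
          (measure_mono hsub).trans (measure_biUnion_finset_le _ _)
      _ ≤ ∑ _j ∈ Finset.range (m + 1), ENNReal.ofReal (K * (1 / ((m : ℝ) + 1)) ^ 2) :=
          Finset.sum_le_sum fun j _ => hJ j
      _ = ENNReal.ofReal (K / ((m : ℝ) + 1)) := by
          rw [Finset.sum_const, Finset.card_range, ← ENNReal.ofReal_nsmul]
          congr 1
          simp only [nsmul_eq_mul]
          push_cast
          field_simp
  have hlim : Tendsto (fun m : ℕ => ENNReal.ofReal (K / ((m : ℝ) + 1))) atTop (𝓝 0) := by
    have := (tendsto_const_nhds (x := K)).div_atTop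
      (tendsto_atTop_add_const_right _ (1 : ℝ) tendsto_natCast_atTop_atTop)
    simpa using ENNReal.tendsto_ofReal this
  exact le_antisymm (ge_of_tendsto' hlim hbound) zero_le

section SelfAdjoint

variable {E : Type*} [NormedAddCommGroup E] [InnerProductSpace ℂ E] [CompleteSpace E]

/-- The positive functional `g ↦ ⟪y, g(H) y⟫` on compactly supported continuous functions. -/
noncomputable def spectralFunctional (H : E →L[ℂ] E) (y : E) : C_c(ℝ, ℝ) →ₚ[ℝ] ℝ :=
  PositiveLinearMap.mk₀
    { toFun := fun g => (⟪y, cfc (g : ℝ → ℝ) H y⟫).re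
      map_add' := fun g h => by
        have : ((g + h : C_c(ℝ, ℝ)) : ℝ → ℝ) = fun x => g x + h x := rfl
        rw [this, cfc_add (a := H) g h (map_continuous g).continuousOn
          (map_continuous h).continuousOn]
        simp
      map_smul' := fun c g => by
        have : ((c • g : C_c(ℝ, ℝ)) : ℝ → ℝ) = fun x => c • g x := rfl
        rw [this, cfc_smul (a := H) c g (map_continuous g).continuousOn]
        simp }
    (fun g hg => by
      have h : 0 ≤ cfc (g : ℝ → ℝ) H := cfc_nonneg fun x _ => hg x
      exact ((ContinuousLinearMap.nonneg_iff_isPositive _).1 h).re_inner_nonneg_right y)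

theorem spectralFunctional_apply (H : E →L[ℂ] E) (y : E) (g : C_c(ℝ, ℝ)) :
    spectralFunctional H y g = (⟪y, cfc (g : ℝ → ℝ) H y⟫).re := rfl

/-- The truncated tent function at `a` with plateau radius `r` and support radius `2 * r`. -/
noncomputable def tent (a r : ℝ) : C(ℝ, ℝ) :=
  ⟨fun x => max 0 (min 1 (2 - |x - a| / r)), by fun_prop⟩

theorem tent_nonneg (a r x : ℝ) : 0 ≤ tent a r x := le_max_left _ _

theorem tent_le_one (a r x : ℝ) : tent a r x ≤ 1 := max_le zero_le_one (min_le_left _ _)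

theorem tent_eq_one {a r x : ℝ} (hr : 0 < r) (hx : x ∈ Metric.closedBall a r) :
    tent a r x = 1 := by
  have : |x - a| / r ≤ 1 := (div_le_one hr).2 hx
  simp only [tent, ContinuousMap.coe_mk]
  rw [min_eq_left (by linarith), max_eq_right zero_le_one]

theorem tent_eq_zero {a r x : ℝ} (hr : 0 < r) (hx : x ∉ Metric.closedBall a (2 * r)) :
    tent a r x = 0 := by
  have : 2 ≤ |x - a| / r := by
    rw [le_div_iff₀ hr]
    exact (not_le.1 hx).le
  exact max_eq_left ((min_le_right _ _).trans (by linarith))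

/-- `tent a r` as a compactly supported function. -/
noncomputable def tentCc (a : ℝ) {r : ℝ} (hr : 0 < r) : C_c(ℝ, ℝ) :=
  ⟨tent a r, HasCompactSupport.intro (isCompact_closedBall a (2 * r)) fun _ hx =>
    tent_eq_zero hr hx⟩

theorem coe_tentCc (a : ℝ) {r : ℝ} (hr : 0 < r) : (tentCc a hr : ℝ → ℝ) = tent a r := rfl

theorem spectralFunctional_tent_le {H : E →L[ℂ] E} (hH : IsSelfAdjoint H) {y z : E} {a r : ℝ}
    (hr : 0 < r) (hz : H z - (a : ℂ) • z = y) :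
    spectralFunctional H y (tentCc a hr) ≤ 4 * ‖z‖ ^ 2 * r ^ 2 := by
  have hsub : cfc (fun x : ℝ => x - a) H = H - algebraMap ℝ _ a := by
    rw [cfc_sub _ _ _ (by fun_prop) (by fun_prop), cfc_id' ℝ H, cfc_const a H]
  have hy : cfc (fun x : ℝ => x - a) H z = y := by
    rw [hsub, ← hz]
    simp [Algebra.algebraMap_eq_smul_one]
  have hprod : cfc (fun x : ℝ => (x - a) * (tent a r x * (x - a))) H =
      cfc (fun x : ℝ => x - a) H * (cfc (tent a r) H * cfc (fun x : ℝ => x - a) H) := by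
    rw [cfc_mul _ _ _ (by fun_prop) (by fun_prop), cfc_mul _ _ _ (by fun_prop) (by fun_prop)]
  have hadj : IsSelfAdjoint (cfc (fun x : ℝ => x - a) H) := IsSelfAdjoint.cfc
  have hnorm : ‖cfc (fun x : ℝ => (x - a) * (tent a r x * (x - a))) H‖ ≤ 4 * r ^ 2 := by
    refine norm_cfc_le (by positivity) fun x _ => ?_
    have heq : (x - a) * (tent a r x * (x - a)) = tent a r x * (x - a) ^ 2 := by ring
    rw [heq, Real.norm_of_nonneg (mul_nonneg (tent_nonneg _ _ _) (sq_nonneg _))]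
    by_cases hx : x ∈ Metric.closedBall a (2 * r)
    · rw [Metric.mem_closedBall, Real.dist_eq] at hx
      have : (x - a) ^ 2 ≤ (2 * r) ^ 2 := by
        rw [← sq_abs]; gcongr
      nlinarith [tent_le_one a r x, tent_nonneg a r x, sq_nonneg (x - a)]
    · rw [tent_eq_zero hr hx]; simp; positivity
  rw [spectralFunctional_apply, coe_tentCc]
  have hinner : ⟪y, cfc (tent a r) H y⟫ =
      ⟪z, cfc (fun x : ℝ => (x - a) * (tent a r x * (x - a))) H z⟫ := by
    rw [hprod, mul_apply_eq_comp, mul_apply_eq_comp, hy]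
    have h : ⟪cfc (fun x : ℝ => x - a) H z, cfc (tent a r) H y⟫ =
        ⟪z, cfc (fun x : ℝ => x - a) H (cfc (tent a r) H y)⟫ := hadj.isSymmetric z _
    rwa [hy] at h
  rw [hinner]
  calc _ ≤ ‖⟪z, cfc (fun x : ℝ => (x - a) * (tent a r x * (x - a))) H z⟫‖ := Complex.re_le_norm _
    _ ≤ ‖z‖ * (4 * r ^ 2 * ‖z‖) := (norm_inner_le_norm _ _).trans
        (mul_le_mul_of_nonneg_left (ContinuousLinearMap.le_of_opNorm_le _ hnorm z) (norm_nonneg _))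
    _ = _ := by ring

/-- A vector in the range of `H - a` for every real `a` vanishes. -/
theorem IsSelfAdjoint.eq_zero_of_forall_mem_range_sub {H : E →L[ℂ] E} (hH : IsSelfAdjoint H)
    {y : E} (hy : ∀ a : ℝ, ∃ z, H z - (a : ℂ) • z = y) : y = 0 := by
  choose z hz using hy
  set μ := RealRMK.rieszMeasure (spectralFunctional H y)
  have hball (a r : ℝ) (hr : 0 < r) :
      μ (Metric.closedBall a r) ≤ ENNReal.ofReal (4 * ‖z a‖ ^ 2 * r ^ 2) :=
    (RealRMK.rieszMeasure_le_of_eq_one _ (f := tentCc a hr) (tent_nonneg a r)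
      (isCompact_closedBall a r) fun x hx => tent_eq_one hr hx).trans
      (ENNReal.ofReal_le_ofReal (spectralFunctional_tent_le hH hr (hz a)))
  have hμ : μ = 0 := by
    rw [← Measure.measure_univ_eq_zero]
    have hcover : (Set.univ : Set ℝ) = ⋃ n : ℕ, {a | ‖z a‖ ^ 2 ≤ n} := by
      symm
      rw [Set.eq_univ_iff_forall]
      intro a
      obtain ⟨n, hn⟩ := exists_nat_ge (‖z a‖ ^ 2)
      exact Set.mem_iUnion.2 ⟨n, hn⟩
    rw [hcover, measure_iUnion_null_iff]
    refine fun n => Real.measure_eq_zero_of_closedBall_le_sq μ (K := 4 * n) fun a ha r hr =>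
      (hball a r hr).trans (ENNReal.ofReal_le_ofReal ?_)
    have ha' : ‖z a‖ ^ 2 ≤ n := ha
    gcongr
  have hr : 0 < ‖H‖ + 1 := by positivity
  have hΛ : spectralFunctional H y (tentCc 0 hr) = 0 := by
    rw [← RealRMK.integral_rieszMeasure]
    change ∫ x, _ ∂μ = 0
    rw [hμ, integral_zero_measure]
  have hone : cfc (tent 0 (‖H‖ + 1)) H = 1 := by
    rw [← cfc_one ℝ H]
    refine cfc_congr fun x hx => ?_
    refine tent_eq_one hr ?_
    rw [mem_closedBall_zero_iff]
    rcases subsingleton_or_nontrivial E with h | h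
    · exact absurd hx (by simp [spectrum.of_subsingleton])
    · exact (spectrum.norm_le_norm_of_mem hx).trans (by linarith)
  rw [spectralFunctional_apply, coe_tentCc, hone, one_apply_eq_self] at hΛ
  simpa using (inner_self_eq_norm_sq (𝕜 := ℂ) y).symm.trans hΛ

end SelfAdjoint

section Propagator

variable {V : Type*} [NormedAddCommGroup V] [NormedSpace ℂ V]

theorem Submodule.integral_mem_of_isClosed [CompleteSpace V] {S : Submodule ℂ V}
    (hS : IsClosed (S : Set V))
    {X : Type*} [MeasurableSpace X] {μ : Measure X} {f : X → V} (hf : ∀ x, f x ∈ S) :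
    ∫ x, f x ∂μ ∈ S := by
  by_cases hi : Integrable f μ
  · rw [← Submodule.Quotient.mk_eq_zero]
    have h := S.mkQL.integral_comp_comm hi
    have h0 (x : X) : S.mkQL (f x) = 0 := (Submodule.Quotient.mk_eq_zero S).2 (hf x)
    simp only [h0, integral_zero] at h
    exact h.symm
  · rw [integral_undef hi]; exact S.zero_mem

theorem Submodule.intervalIntegral_mem_of_isClosed [CompleteSpace V] {S : Submodule ℂ V}
    (hS : IsClosed (S : Set V)) {f : ℝ → V} (hf : ∀ x, f x ∈ S) (a b : ℝ) :
    ∫ x in a..b, f x ∈ S := by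
  rw [intervalIntegral]
  exact S.sub_mem (integral_mem_of_isClosed hS hf) (integral_mem_of_isClosed hS hf)

/-- The one-parameter group `t ↦ exp (i t T)` generated by a bounded operator. -/
noncomputable def propagator (T : V →L[ℂ] V) (t : ℝ) : V →L[ℂ] V :=
  NormedSpace.exp (t • (Complex.I • T))

theorem propagator_zero (T : V →L[ℂ] V) : propagator T 0 = 1 := by
  simp [propagator]

variable [CompleteSpace V]

theorem propagator_apply_propagator_neg (T : V →L[ℂ] V) (t : ℝ) (v : V) :
    propagator T t (propagator T (-t) v) = v := by
  have h : propagator T t * propagator T (-t) = 1 := by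
    let _ : NormedAlgebra ℚ (V →L[ℂ] V) := .restrictScalars ℚ ℂ _
    have := NormedSpace.exp_add_of_commute
      (Commute.neg_right (Commute.refl (t • (Complex.I • T))))
    rw [add_neg_cancel, NormedSpace.exp_zero] at this
    rw [propagator, propagator, neg_smul, ← this]
  exact congrArg (· v) h

theorem hasDerivAt_propagator (T : V →L[ℂ] V) (t : ℝ) :
    HasDerivAt (propagator T) (propagator T t * (Complex.I • T)) t :=
  hasDerivAt_exp_smul_const (𝕂 := ℝ) (Complex.I • T) t

theorem continuous_propagator (T : V →L[ℂ] V) : Continuous (propagator T) :=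
  continuous_iff_continuousAt.2 fun t => (hasDerivAt_propagator T t).continuousAt

theorem hasDerivAt_propagator_apply (T : V →L[ℂ] V) (v : V) (t : ℝ) :
    HasDerivAt (fun s => propagator T s v) (Complex.I • T (propagator T t v)) t := by
  have h := hasDerivAt_exp_smul_const' (𝕂 := ℝ) (Complex.I • T) t
  exact ((ContinuousLinearMap.apply ℂ V v).restrictScalars ℝ).hasFDerivAt.comp_hasDerivAt t h

theorem propagator_apply_mem {S : Submodule ℂ V} (hS : IsClosed (S : Set V)) {T : V →L[ℂ] V}
    (hT : ∀ v ∈ S, T v ∈ S) (t : ℝ) {v : V} (hv : v ∈ S) : propagator T t v ∈ S := by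
  have hsum := (NormedSpace.exp_series_hasSum_exp' (𝕂 := ℂ) (t • (Complex.I • T))).mapL
    (ContinuousLinearMap.apply ℂ V v)
  refine hS.mem_of_tendsto hsum (Eventually.of_forall fun s => S.sum_mem fun n _ => ?_)
  have hpow (n : ℕ) : ((t • (Complex.I • T)) ^ n) v ∈ S := by
    induction n with
    | zero => simpa using hv
    | succ n ih =>
      rw [pow_succ', mul_apply_eq_comp]
      exact S.smul_of_tower_mem t (S.smul_mem _ (hT _ ih))
  exact S.smul_mem _ (hpow n)

end Propagator

section Duhamel

variable {E : Type*} [NormedAddCommGroup E] [InnerProductSpace ℂ E]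

/-- The block operator `(x, y) ↦ (H x, C x + H y)`. -/
noncomputable def commutatorBlock (H C : E →L[ℂ] E) : (E × E) →L[ℂ] (E × E) :=
  (H ∘L ContinuousLinearMap.fst ℂ E E).prod
    (C ∘L ContinuousLinearMap.fst ℂ E E + H ∘L ContinuousLinearMap.snd ℂ E E)

theorem commutatorBlock_apply (H C : E →L[ℂ] E) (p : E × E) :
    commutatorBlock H C p = (H p.1, C p.1 + H p.2) := rfl

variable [CompleteSpace E]

theorem norm_propagator_apply {H : E →L[ℂ] E} (hH : IsSelfAdjoint H) (t : ℝ) (v : E) :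
    ‖propagator H t v‖ = ‖v‖ := by
  have hself : IsSelfAdjoint (t • H) := (IsSelfAdjoint.all t).smul hH
  have hexp : propagator H t = (selfAdjoint.expUnitary ⟨t • H, hself⟩ : E →L[ℂ] E) := by
    rw [selfAdjoint.expUnitary_coe, propagator, smul_comm]
  rw [hexp]
  exact ContinuousLinearMap.norm_map_of_mem_unitary (selfAdjoint.expUnitary ⟨t • H, hself⟩).2 v

/-- Perturbation bound for solutions of `dv/dt = i (H v + g)`. -/
theorem norm_sub_propagator_apply_le {H : E →L[ℂ] E} (hH : IsSelfAdjoint H) {v g : ℝ → E}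
    {M : ℝ} (hv : ∀ t, HasDerivAt v (Complex.I • (H (v t) + g t)) t) (hg : ∀ t, ‖g t‖ ≤ M)
    (t : ℝ) : ‖v t - propagator H t (v 0)‖ ≤ M * |t| := by
  have hw (s : ℝ) : HasDerivAt (fun s => propagator H (-s) (v s))
      (propagator H (-s) (Complex.I • g s)) s := by
    have h1 : HasDerivAt (fun s => propagator H (-s))
        (-(propagator H (-s) * (Complex.I • H))) s :=
      ((hasDerivAt_propagator H (-s)).scomp s (hasDerivAt_neg s)).congr_deriv (neg_one_smul ℝ _)
    have h2 := ((ContinuousLinearMap.restrictScalarsL ℂ E E ℝ ℝ).hasFDerivAt.comp_hasDerivAt s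
      h1).clm_apply (hv s)
    refine h2.congr_deriv ?_
    simp [mul_apply_eq_comp]
  have h := convex_univ.norm_image_sub_le_of_norm_hasDerivWithin_le
    (fun s _ => (hw s).hasDerivWithinAt) (C := M)
    (fun s _ => by rw [norm_propagator_apply hH, norm_smul]; simpa using hg s)
    (Set.mem_univ 0) (Set.mem_univ t)
  rw [← norm_propagator_apply hH t, map_sub, propagator_apply_propagator_neg] at h
  simpa [propagator_zero] using h

theorem fst_propagator_commutatorBlock {H : E →L[ℂ] E} (hH : IsSelfAdjoint H) (C : E →L[ℂ] E)
    (p : E × E) (t : ℝ) : (propagator (commutatorBlock H C) t p).1 = propagator H t p.1 := by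
  have h := norm_sub_propagator_apply_le hH (g := fun _ => 0) (M := 0)
    (v := fun s => (propagator (commutatorBlock H C) s p).1)
    (fun s => by
      refine ((ContinuousLinearMap.fst ℝ E E).hasFDerivAt.comp_hasDerivAt s
        (hasDerivAt_propagator_apply (commutatorBlock H C) p s)).congr_deriv ?_
      simp [commutatorBlock_apply]) (by simp) t
  rw [zero_mul, norm_le_zero_iff, sub_eq_zero] at h
  simpa [propagator_zero] using h

theorem norm_snd_propagator_commutatorBlock_sub_le {H : E →L[ℂ] E} (hH : IsSelfAdjoint H)
    (C : E →L[ℂ] E) (p : E × E) (t : ℝ) :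
    ‖(propagator (commutatorBlock H C) t p).2 - propagator H t p.2‖ ≤ ‖C‖ * ‖p.1‖ * |t| := by
  have h := norm_sub_propagator_apply_le hH (M := ‖C‖ * ‖p.1‖)
    (g := fun s => C (propagator H s p.1))
    (v := fun s => (propagator (commutatorBlock H C) s p).2)
    (fun s => by
      refine ((ContinuousLinearMap.snd ℝ E E).hasFDerivAt.comp_hasDerivAt s
        (hasDerivAt_propagator_apply (commutatorBlock H C) p s)).congr_deriv ?_
      simp [commutatorBlock_apply, fst_propagator_commutatorBlock hH, add_comm])
    (fun s => by
      rw [← norm_propagator_apply hH s p.1]; exact C.le_opNorm _) t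
  simpa [propagator_zero] using h

theorem norm_propagator_commutatorBlock_le {H : E →L[ℂ] E} (hH : IsSelfAdjoint H)
    (C : E →L[ℂ] E) (p : E × E) (t : ℝ) :
    ‖propagator (commutatorBlock H C) t p‖ ≤ (1 + ‖C‖) * ‖p‖ * (1 + |t|) := by
  have h1 : ‖p.1‖ ≤ ‖p‖ := norm_fst_le p
  have h2 : ‖p.2‖ ≤ ‖p‖ := norm_snd_le p
  have hCt : 0 ≤ ‖C‖ * ‖p‖ := by positivity
  have hpt : 0 ≤ ‖p‖ * |t| := by positivity
  rw [Prod.norm_def, max_le_iff]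
  constructor
  · rw [fst_propagator_commutatorBlock hH, norm_propagator_apply hH]
    nlinarith [mul_nonneg hCt (abs_nonneg t)]
  · have h3 := norm_snd_propagator_commutatorBlock_sub_le hH C p t
    have h4 := norm_sub_norm_le (propagator (commutatorBlock H C) t p).2 (propagator H t p.2)
    rw [norm_propagator_apply hH] at h4
    have h5 : ‖C‖ * ‖p.1‖ * |t| ≤ ‖C‖ * ‖p‖ * |t| := by gcongr
    nlinarith

end Duhamel

section Unbounded

variable {E : Type*} [NormedAddCommGroup E] [InnerProductSpace ℂ E]

/-- The graph of the adjoint relation of `Dop`. -/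
def adjointGraph (dom : Submodule ℂ E) (Dop : dom →ₗ[ℂ] E) : Submodule ℂ (E × E) where
  carrier := {p | ∀ φ : dom, ⟪Dop φ, p.1⟫ = ⟪(φ : E), p.2⟫}
  zero_mem' := by simp
  add_mem' hp hq φ := by simp only [Prod.fst_add, Prod.snd_add, inner_add_right, hp φ, hq φ]
  smul_mem' c p hp φ := by simp only [Prod.smul_fst, Prod.smul_snd, inner_smul_right, hp φ]

theorem isClosed_adjointGraph (dom : Submodule ℂ E) (Dop : dom →ₗ[ℂ] E) :
    IsClosed (adjointGraph dom Dop : Set (E × E)) := by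
  have : (adjointGraph dom Dop : Set (E × E)) =
      ⋂ φ : dom, {p | ⟪Dop φ, p.1⟫ = ⟪(φ : E), p.2⟫} := by
    ext p; simp [adjointGraph]
  rw [this]
  exact isClosed_iInter fun φ => isClosed_eq (by fun_prop) (by fun_prop)

theorem commutatorBlock_mem_adjointGraph [CompleteSpace E] {dom : Submodule ℂ E}
    {Dop : dom →ₗ[ℂ] E}
    (hsymm : ∀ ψ φ : dom, ⟪Dop ψ, (φ : E)⟫ = ⟪(ψ : E), Dop φ⟫)
    (hdom : ∀ p ∈ adjointGraph dom Dop, p.1 ∈ dom)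
    {H C : E →L[ℂ] E} (hH : IsSelfAdjoint H) (hpres : ∀ x ∈ dom, H x ∈ dom)
    (hC : ∀ ψ : dom, C (ψ : E) = Dop ⟨H ψ, hpres _ ψ.2⟩ - H (Dop ψ))
    {p : E × E} (hp : p ∈ adjointGraph dom Dop) :
    commutatorBlock H C p ∈ adjointGraph dom Dop := by
  intro φ
  have hHs (u v : E) : ⟪H u, v⟫ = ⟪u, H v⟫ := hH.isSymmetric u v
  let x : dom := ⟨p.1, hdom p hp⟩
  have h1 := hsymm φ ⟨H x, hpres _ x.2⟩
  have h2 := hp ⟨H φ, hpres _ φ.2⟩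
  have h3 := hsymm ⟨H φ, hpres _ φ.2⟩ x
  rw [commutatorBlock_apply, inner_add_right]
  change ⟪Dop φ, H x⟫ = ⟪(φ : E), C x⟫ + _
  rw [hC x, inner_sub_right, ← hHs (φ : E) (Dop x), ← hHs (φ : E) p.2]
  change _ = ⟪H φ, Dop x⟫ at h3
  change _ = ⟪H φ, p.2⟫ at h2
  rw [← h3, ← h2]
  change ⟪Dop φ, H x⟫ = _ at h1
  rw [h1]
  exact (sub_add_cancel _ _).symm

/-- Functions bounded by `A (1 + |t|) ^ 2` are integrable against a weight with two moments. -/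
theorem integrable_smul_of_norm_le {V : Type*} [NormedAddCommGroup V] [NormedSpace ℂ V]
    {k : ℝ → ℂ} (hk : Continuous k) (hint : Integrable fun t => (1 + |t|) ^ 2 * ‖k t‖)
    {F : ℝ → V} (hF : Continuous F) {A : ℝ} (hA : ∀ t, ‖F t‖ ≤ A * (1 + |t|) ^ 2) :
    Integrable fun t => k t • F t := by
  refine (hint.const_mul A).mono' ?_ (Eventually.of_forall fun t => ?_)
  · exact (hk.smul hF).aestronglyMeasurable
  · rw [norm_smul]
    nlinarith [mul_le_mul_of_nonneg_left (hA t) (norm_nonneg (k t))]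

theorem exists_sub_smul_eq_propagator {V : Type*} [NormedAddCommGroup V] [NormedSpace ℂ V]
    [CompleteSpace V] {S : Submodule ℂ V} (hS : IsClosed (S : Set V)) {T : V →L[ℂ] V}
    (hT : ∀ v ∈ S, T v ∈ S) {v : V} (hv : v ∈ S) {A : ℝ}
    (hA : ∀ t, ‖propagator T t v‖ ≤ A * (1 + |t|)) (a : ℝ) :
    ∃ Y : ℝ → V, Continuous Y ∧ (∀ t, Y t ∈ S) ∧ (∀ t, ‖Y t‖ ≤ A * (1 + |t|) ^ 2) ∧
      ∀ t, T (Y t) - (a : ℂ) • Y t =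
        propagator T t v - Complex.exp (↑(t * a) * Complex.I) • v := by
  let e (t : ℝ) : ℂ := Complex.exp (↑(t * a) * Complex.I)
  have he : Continuous e := by fun_prop
  have hnorm (t : ℝ) : ‖e t‖ = 1 := Complex.norm_exp_ofReal_mul_I _
  have hprop : Continuous fun t => propagator T t v :=
    continuous_iff_continuousAt.2 fun t => (hasDerivAt_propagator_apply T v t).continuousAt
  let G (s : ℝ) : V := Complex.I • e (-s) • propagator T s v
  have hG : Continuous G := ((he.comp continuous_neg).smul hprop).const_smul _
  have hGS (s : ℝ) : G s ∈ S :=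
    S.smul_mem _ (S.smul_mem _ (propagator_apply_mem hS hT s hv))
  have hA0 : 0 ≤ A := by simpa using (norm_nonneg _).trans (hA 0)
  refine ⟨fun t => e t • ∫ s in (0 : ℝ)..t, G s, ?_, ?_, ?_, ?_⟩
  · exact he.smul (intervalIntegral.continuous_primitive
      (fun a b => hG.intervalIntegrable a b) 0)
  · exact fun t => S.smul_mem _ (Submodule.intervalIntegral_mem_of_isClosed hS hGS _ _)
  · intro t
    rw [norm_smul, hnorm, one_mul]
    have h := intervalIntegral.norm_integral_le_of_norm_le_const (f := G) (a := 0) (b := t)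
      (C := A * (1 + |t|)) fun s hs => by
        have hst : |s| ≤ |t| := by
          have := Set.abs_sub_left_of_mem_uIcc (Set.uIoc_subset_uIcc hs)
          simpa using this
        rw [norm_smul, norm_smul, hnorm, Complex.norm_I, one_mul, one_mul]
        exact (hA s).trans (by gcongr)
    rw [sub_zero] at h
    nlinarith [mul_nonneg hA0 (abs_nonneg t), abs_nonneg t]
  · intro t
    let R : V →L[ℂ] V := T - (a : ℂ) • 1
    have hR (u : V) : T u - (a : ℂ) • u = R u := rfl
    have hderiv (s : ℝ) : HasDerivAt (fun s => e (-s) • propagator T s v) (R (G s)) s := by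
      have h1 : HasDerivAt (fun s : ℝ => e (-s)) (e (-s) * (-(a : ℂ) * Complex.I)) s := by
        have h0 : HasDerivAt (fun s : ℝ => (↑(-s * a) : ℂ) * Complex.I)
            (-(a : ℂ) * Complex.I) s := by
          have := (((hasDerivAt_id s).neg.mul_const a).ofReal_comp).mul_const Complex.I
          simpa using this
        exact h0.cexp
      refine (h1.smul (hasDerivAt_propagator_apply T v s)).congr_deriv ?_
      simp only [G, ← hR, map_smul]
      module
    have hFTC : R (∫ s in (0 : ℝ)..t, G s) = e (-t) • propagator T t v - v := by
      rw [← R.intervalIntegral_comp_comm (hG.intervalIntegrable _ _),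
        intervalIntegral.integral_eq_sub_of_hasDerivAt (fun s _ => hderiv s)
          ((R.continuous.comp hG).intervalIntegrable _ _)]
      simp [e, propagator_zero]
    have hee : e t * e (-t) = 1 := by
      simp only [e]
      rw [← Complex.exp_add]
      simp
    rw [hR, map_smul, hFTC, smul_sub, smul_smul, hee, one_smul]

/-- If `p` lies in a relation on which the block operator acts, the defect `y - D x` of
`(x, y) = ∫ k(t) exp(i t T) p` vanishes as soon as the one of `p` does. -/
theorem integral_propagator_snd_eq [CompleteSpace E] {dom : Submodule ℂ E} {Dop : dom →ₗ[ℂ] E}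
    (hdom : ∀ p ∈ adjointGraph dom Dop, p.1 ∈ dom)
    {H C : E →L[ℂ] E} (hH : IsSelfAdjoint H) (hpres : ∀ x ∈ dom, H x ∈ dom)
    (hC : ∀ ψ : dom, C (ψ : E) = Dop ⟨H ψ, hpres _ ψ.2⟩ - H (Dop ψ))
    (hT : ∀ p ∈ adjointGraph dom Dop, commutatorBlock H C p ∈ adjointGraph dom Dop)
    {k : ℝ → ℂ} (hk : Continuous k) (hint : Integrable fun t => (1 + |t|) ^ 2 * ‖k t‖)
    {p : E × E} (hp : p ∈ adjointGraph dom Dop) (hp2 : p.2 = Dop ⟨p.1, hdom p hp⟩) :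
    ∃ hmem : (∫ t, k t • propagator (commutatorBlock H C) t p) ∈ adjointGraph dom Dop,
      (∫ t, k t • propagator (commutatorBlock H C) t p).2 = Dop ⟨_, hdom _ hmem⟩ := by
  set T := commutatorBlock H C
  set S := adjointGraph dom Dop
  have hS : IsClosed (S : Set (E × E)) := isClosed_adjointGraph dom Dop
  have hbound := norm_propagator_commutatorBlock_le hH C p
  have hA0 : 0 ≤ (1 + ‖C‖) * ‖p‖ := by positivity
  have hprop : Continuous fun t => propagator T t p :=
    continuous_iff_continuousAt.2 fun t => (hasDerivAt_propagator_apply T p t).continuousAt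
  have hint1 : Integrable fun t => k t • propagator T t p :=
    integrable_smul_of_norm_le hk hint hprop fun t => (hbound t).trans
      (mul_le_mul_of_nonneg_left (by nlinarith [abs_nonneg t]) hA0)
  have hmem : (∫ t, k t • propagator T t p) ∈ S :=
    Submodule.integral_mem_of_isClosed hS fun t =>
      S.smul_mem _ (propagator_apply_mem hS hT t hp)
  refine ⟨hmem, ?_⟩
  let δ : S →ₗ[ℂ] E :=
    LinearMap.snd ℂ E E ∘ₗ S.subtype -
      Dop ∘ₗ (LinearMap.fst ℂ E E ∘ₗ S.subtype).codRestrict dom fun q => hdom q q.2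
  have hδ (q : S) : δ q = (q : E × E).2 - Dop ⟨(q : E × E).1, hdom q q.2⟩ := rfl
  have hδT (q : S) : δ ⟨T q, hT q q.2⟩ = H (δ q) := by
    rw [hδ, hδ]
    have := hC ⟨(q : E × E).1, hdom q q.2⟩
    change (C (q : E × E).1 + H (q : E × E).2) - _ = _
    rw [map_sub, this]
    change _ - _ + _ - Dop ⟨H (q : E × E).1, _⟩ = _
    abel
  rw [← sub_eq_zero]
  change δ ⟨_, hmem⟩ = 0
  refine hH.eq_zero_of_forall_mem_range_sub fun a => ?_
  obtain ⟨Y, hYc, hYS, hYb, hY⟩ := exists_sub_smul_eq_propagator hS hT hp hbound a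
  have hintY := integrable_smul_of_norm_le hk hint hYc hYb
  have hYmem : (∫ t, k t • Y t) ∈ S :=
    Submodule.integral_mem_of_isClosed hS fun t => S.smul_mem _ (hYS t)
  have hinte : Integrable fun t : ℝ => k t • Complex.exp (↑(t * a) * Complex.I) :=
    integrable_smul_of_norm_le hk hint (by fun_prop) (A := 1) fun t => by
      rw [Complex.norm_exp_ofReal_mul_I]
      nlinarith [abs_nonneg t]
  set c : ℂ := ∫ t, k t • Complex.exp (↑(t * a) * Complex.I)
  let R : (E × E) →L[ℂ] (E × E) := T - (a : ℂ) • 1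
  have hR (u : E × E) : R u = T u - (a : ℂ) • u := rfl
  have hkey : T (∫ t, k t • Y t) - (a : ℂ) • (∫ t, k t • Y t) =
      (∫ t, k t • propagator T t p) - c • p := by
    rw [← hR, ← R.integral_comp_comm hintY, ← integral_smul_const,
      ← integral_sub hint1 (hinte.smul_const p)]
    refine integral_congr_ae (Eventually.of_forall fun t => ?_)
    simp only
    rw [R.map_smul, hR, hY, smul_sub, smul_assoc]
  refine ⟨δ ⟨_, hYmem⟩, ?_⟩
  have hδp : δ ⟨p, hp⟩ = 0 := by rw [hδ, ← hp2, sub_self]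
  rw [← hδT, ← map_smul, ← map_sub]
  have : (⟨T (∫ t, k t • Y t), hT _ hYmem⟩ - (a : ℂ) • ⟨_, hYmem⟩ : S) =
      ⟨_, hmem⟩ - c • ⟨p, hp⟩ := Subtype.ext hkey
  rw [this, map_sub, map_smul, hδp, smul_zero, sub_zero]

theorem exists_integral_propagator_mem_and_norm_le [CompleteSpace E] {dom : Submodule ℂ E}
    {Dop : dom →ₗ[ℂ] E}
    (hsymm : ∀ ψ φ : dom, ⟪Dop ψ, (φ : E)⟫ = ⟪(ψ : E), Dop φ⟫)
    (hmax : ∀ y w : E, (∀ ψ : dom, ⟪Dop ψ, y⟫ = ⟪(ψ : E), w⟫) → y ∈ dom)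
    {H C : E →L[ℂ] E} (hH : IsSelfAdjoint H) (hpres : ∀ x ∈ dom, H x ∈ dom)
    (hC : ∀ ψ : dom, C (ψ : E) = Dop ⟨H ψ, hpres _ ψ.2⟩ - H (Dop ψ))
    {k : ℝ → ℂ} (hk : Continuous k) (hint : Integrable fun t => (1 + |t|) ^ 2 * ‖k t‖)
    (ψ : dom) :
    ∃ hmem : (∫ t, k t • propagator H t ψ) ∈ dom,
      ‖Dop ⟨_, hmem⟩ - ∫ t, k t • propagator H t (Dop ψ)‖ ≤
        (∫ t, |t| * ‖k t‖) * ‖C‖ * ‖(ψ : E)‖ := by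
  have hdom : ∀ p ∈ adjointGraph dom Dop, p.1 ∈ dom := fun p hp => hmax p.1 p.2 hp
  have hT := fun p (hp : p ∈ adjointGraph dom Dop) =>
    commutatorBlock_mem_adjointGraph hsymm hdom hH hpres hC hp
  have hp : ((ψ : E), Dop ψ) ∈ adjointGraph dom Dop := fun φ => hsymm φ ψ
  obtain ⟨hmem, heq⟩ := integral_propagator_snd_eq hdom hH hpres hC hT hk hint hp rfl
  set T := commutatorBlock H C
  have hprop {V : Type _} [NormedAddCommGroup V] [NormedSpace ℂ V] [CompleteSpace V]
      (T : V →L[ℂ] V) (v : V) : Continuous fun t => propagator T t v :=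
    continuous_iff_continuousAt.2 fun t => (hasDerivAt_propagator_apply T v t).continuousAt
  have hint1 : Integrable fun t => k t • propagator T t ((ψ : E), Dop ψ) :=
    integrable_smul_of_norm_le hk hint (hprop _ _) fun t =>
      (norm_propagator_commutatorBlock_le hH C _ t).trans
        (mul_le_mul_of_nonneg_left (by nlinarith [abs_nonneg t]) (by positivity))
  have hint2 : Integrable fun t => k t • propagator H t (Dop ψ) :=
    integrable_smul_of_norm_le hk hint (hprop _ _) (A := ‖Dop ψ‖) fun t => by
      rw [norm_propagator_apply hH]
      exact le_mul_of_one_le_right (norm_nonneg _) (by nlinarith [abs_nonneg t])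
  have hfst : (∫ t, k t • propagator T t ((ψ : E), Dop ψ)).1 = ∫ t, k t • propagator H t ψ := by
    rw [fst_integral hint1]
    simp only [Prod.smul_fst, T, fst_propagator_commutatorBlock hH]
  have hsnd := snd_integral hint1
  have hmem' : (∫ t, k t • propagator H t ψ) ∈ dom := hfst ▸ hdom _ hmem
  refine ⟨hmem', ?_⟩
  have hD : Dop ⟨_, hmem'⟩ = ∫ t, (k t • propagator T t ((ψ : E), Dop ψ)).2 := by
    rw [← hsnd, heq]
    congr 2
    exact hfst.symm
  have hint3 : Integrable fun t => |t| * ‖k t‖ :=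
    hint.mono' (by fun_prop) (Eventually.of_forall fun t => by
      rw [Real.norm_of_nonneg (by positivity)]
      exact mul_le_mul_of_nonneg_right (by nlinarith [abs_nonneg t]) (norm_nonneg _))
  rw [hD, ← integral_sub hint1.snd hint2, mul_assoc, ← integral_mul_const]
  refine norm_integral_le_of_norm_le (hint3.mul_const _) (Eventually.of_forall fun t => ?_)
  rw [Prod.smul_snd, ← smul_sub, norm_smul]
  have := norm_snd_propagator_commutatorBlock_sub_le hH C ((ψ : E), Dop ψ) t
  calc _ ≤ ‖k t‖ * (‖C‖ * ‖(ψ : E)‖ * |t|) := by gcongr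
    _ = _ := by ring

end Unbounded

section FourierWeight

open FourierTransform

/-- The complexification of a real-valued Schwartz function. -/
noncomputable def SchwartzMap.complexify (f : SchwartzMap ℝ ℝ) : SchwartzMap ℝ ℂ :=
  SchwartzMap.postcompCLM Complex.ofRealCLM f

theorem SchwartzMap.complexify_apply (f : SchwartzMap ℝ ℝ) (x : ℝ) : f.complexify x = f x :=
  SchwartzMap.postcompCLM_apply _ _ _

/-- The weight `k` for which `f x = ∫ k(t) exp (i t x) dt`. -/
noncomputable def fourierWeight (f : SchwartzMap ℝ ℝ) (t : ℝ) : ℂ :=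
  (2 * Real.pi : ℝ)⁻¹ • (𝓕 f.complexify) (t / (2 * Real.pi))

theorem continuous_fourierWeight (f : SchwartzMap ℝ ℝ) : Continuous (fourierWeight f) := by
  have := (𝓕 f.complexify).continuous
  unfold fourierWeight
  fun_prop

theorem integrable_sq_mul_norm_fourierWeight (f : SchwartzMap ℝ ℝ) :
    Integrable fun t => (1 + |t|) ^ 2 * ‖fourierWeight f t‖ := by
  set g := 𝓕 f.complexify
  have h0 : Integrable fun x => ‖g x‖ := g.integrable.norm
  have h1 := g.integrable_pow_mul volume 1
  have h2 := g.integrable_pow_mul volume 2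
  have h := (((h0.const_mul (2 * Real.pi)⁻¹).add (h1.const_mul 2)).add
    (h2.const_mul (2 * Real.pi))).comp_div Real.two_pi_pos.ne'
  refine h.congr (Eventually.of_forall fun t => ?_)
  simp only [Pi.add_apply, fourierWeight, norm_smul, Real.norm_eq_abs, abs_div, abs_inv,
    abs_of_pos Real.two_pi_pos]
  have := Real.pi_ne_zero
  field_simp
  ring

theorem SchwartzMap.complexify_eq_integral (f : SchwartzMap ℝ ℝ) (x : ℝ) :
    (f x : ℂ) = ∫ t : ℝ, fourierWeight f t * Complex.exp (t * Complex.I * x) := by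
  have h := Continuous.fourierInv_fourier_eq f.complexify.continuous f.complexify.integrable
    (by rw [← SchwartzMap.fourier_coe]; exact (𝓕 f.complexify).integrable)
  have hx := congrFun h x
  rw [Real.fourierInv_eq', ← SchwartzMap.fourier_coe, f.complexify_apply] at hx
  rw [← hx]
  have hc := Measure.integral_comp_div (fun v : ℝ =>
    Complex.exp (↑(2 * Real.pi * inner ℝ v x) * Complex.I) •
      (𝓕 f.complexify) v) (2 * Real.pi)
  rw [abs_of_pos Real.two_pi_pos, ← inv_smul_eq_iff₀ Real.two_pi_pos.ne', ← integral_smul] at hc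
  rw [← hc]
  refine integral_congr_ae (Eventually.of_forall fun t => ?_)
  have harg : 2 * Real.pi * inner ℝ (t / (2 * Real.pi)) x = t * x := by
    simp only [RCLike.inner_apply, conj_trivial]
    have := Real.pi_ne_zero
    field_simp
  simp only [harg, fourierWeight, smul_mul_assoc, smul_eq_mul]
  rw [mul_comm (Complex.exp _)]
  congr 3
  push_cast
  ring

theorem abs_mul_norm_fourierWeight (f : SchwartzMap ℝ ℝ) (t : ℝ) :
    |t| * ‖fourierWeight f t‖ = (2 * Real.pi)⁻¹ *
      ‖∫ x : ℝ, Complex.exp (-(Complex.I * t * x)) * ((deriv (f : ℝ → ℝ) x : ℝ) : ℂ)‖ := by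
  have hderiv : deriv (f.complexify : ℝ → ℂ) = fun x => ((deriv (f : ℝ → ℝ) x : ℝ) : ℂ) := by
    funext x
    have : (f.complexify : ℝ → ℂ) = fun x => (f x : ℂ) := funext f.complexify_apply
    rw [this]
    exact (f.differentiableAt.hasDerivAt.ofReal_comp).deriv
  have h := congrFun (Real.fourier_deriv f.complexify.integrable f.complexify.differentiable
    (SchwartzMap.derivCLM ℝ ℂ f.complexify).integrable) (t / (2 * Real.pi))
  rw [Real.fourier_real_eq_integral_exp_smul, hderiv, ← SchwartzMap.fourier_coe] at h
  have hint : ∫ x : ℝ, Complex.exp (-(Complex.I * t * x)) * ((deriv (f : ℝ → ℝ) x : ℝ) : ℂ) =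
      (t * Complex.I) • (𝓕 f.complexify) (t / (2 * Real.pi)) := by
    have hpi : (Real.pi : ℂ) ≠ 0 := Complex.ofReal_ne_zero.2 Real.pi_ne_zero
    have hcoef : 2 * (Real.pi : ℂ) * Complex.I * ↑(t / (2 * Real.pi)) = t * Complex.I := by
      push_cast
      field_simp
    rw [← hcoef, ← h]
    refine integral_congr_ae (Eventually.of_forall fun x => ?_)
    simp only [smul_eq_mul]
    congr 2
    push_cast
    field_simp
  rw [hint, fourierWeight, norm_smul, norm_smul]
  simp only [norm_mul, Complex.norm_real, Complex.norm_I, Real.norm_eq_abs, abs_inv,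
    abs_of_pos Real.two_pi_pos]
  ring

end FourierWeight

section FunctionalCalculus

variable {E : Type*} [NormedAddCommGroup E] [InnerProductSpace ℂ E] [CompleteSpace E]

theorem propagator_eq_cfc {H : E →L[ℂ] E} (hH : IsSelfAdjoint H) (t : ℝ) :
    propagator H t = cfc (fun z : ℂ => Complex.exp (t * Complex.I * z)) H := by
  have hn : IsStarNormal H := hH.isStarNormal
  have hs : t • (Complex.I • H) = ((t : ℂ) * Complex.I) • H := by
    rw [mul_smul, Complex.coe_smul]
  have hn' : IsStarNormal (((t : ℂ) * Complex.I) • H) := inferInstance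
  rw [propagator, hs, ← CFC.complex_exp_eq_normedSpace_exp hn',
    cfc_comp_const_mul _ Complex.exp H (by fun_prop)]

theorem integrable_smul_propagator {H : E →L[ℂ] E} (hH : IsSelfAdjoint H) {k : ℝ → ℂ}
    (hk : Continuous k) (hint : Integrable fun t => (1 + |t|) ^ 2 * ‖k t‖) :
    Integrable fun t => k t • propagator H t :=
  integrable_smul_of_norm_le hk hint (continuous_propagator H) (A := 1) fun t =>
    (ContinuousLinearMap.opNorm_le_bound _ zero_le_one fun v => by
      rw [norm_propagator_apply hH, one_mul]).trans (by nlinarith [abs_nonneg t])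

theorem cfc_schwartzMap_apply {H : E →L[ℂ] E} (hH : IsSelfAdjoint H) (f : SchwartzMap ℝ ℝ)
    (v : E) : cfc (fun x : ℝ => f x) H v = ∫ t, fourierWeight f t • propagator H t v := by
  have hk := continuous_fourierWeight f
  have hint := integrable_sq_mul_norm_fourierWeight f
  have hn : IsStarNormal H := hH.isStarNormal
  have hre {z : ℂ} (hz : z ∈ spectrum ℂ H) : z = z.re := hH.mem_spectrum_eq_re hz
  have hk1 : Integrable fun t => ‖fourierWeight f t‖ :=
    hint.mono' (by fun_prop) (Eventually.of_forall fun t => by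
      rw [norm_norm]
      exact le_mul_of_one_le_left (norm_nonneg _) (by nlinarith [abs_nonneg t]))
  have hcfc : cfc (fun x : ℝ => f x) H = ∫ t, fourierWeight f t • propagator H t := by
    rw [cfc_real_eq_complex (fun x => f x) hH]
    have h1 : cfc (fun z : ℂ => ((f z.re : ℝ) : ℂ)) H =
        cfc (fun z : ℂ => ∫ t : ℝ, fourierWeight f t * Complex.exp (t * Complex.I * z)) H :=
      cfc_congr fun z hz => by
        rw [f.complexify_eq_integral, ← hre hz]
    rw [h1, cfc_integral _ (fun t => ‖fourierWeight f t‖) H (Continuous.continuousOn (by fun_prop))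
      (Eventually.of_forall fun t z hz => ?_) hk1.hasFiniteIntegral hn]
    · refine integral_congr_ae (Eventually.of_forall fun t => ?_)
      simp only
      rw [cfc_const_mul _ _ H (by fun_prop), propagator_eq_cfc hH]
    · rw [norm_mul, hre hz, mul_right_comm, ← Complex.ofReal_mul, Complex.norm_exp_ofReal_mul_I,
        mul_one]
  rw [hcfc, ContinuousLinearMap.integral_apply (integrable_smul_propagator hH hk hint)]
  rfl

end FunctionalCalculus

/-- Commutator estimate for smooth functional calculus: if `D` is self-adjoint (possibly
unbounded) and `H` is bounded self-adjoint preserving `Dom(D)` with bounded commutator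
`[D,H]`, then for every Schwartz function `f : ℝ → ℝ`, `f(H)` preserves `Dom(D)` and
`‖[D, f(H)]‖ ≤ (2π)⁻¹ ‖ℱ(f')‖_{L¹} ‖[D,H]‖`, where `ℱ` is the (unnormalized) Fourier
transform `(ℱ g)(t) = ∫ e^{-itx} g(x) dx`. -/
theorem stmt_10 {E : Type*} [NormedAddCommGroup E] [InnerProductSpace ℂ E] [CompleteSpace E]
    (dom : Submodule ℂ E) (Dop : dom →ₗ[ℂ] E)
    (hsymm : ∀ ψ φ : dom, ⟪Dop ψ, (φ : E)⟫ = ⟪(ψ : E), Dop φ⟫)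
    (hmax : ∀ y w : E, (∀ ψ : dom, ⟪Dop ψ, y⟫ = ⟪(ψ : E), w⟫) → y ∈ dom)
    (H : E →L[ℂ] E) (hH : IsSelfAdjoint H)
    (hpres : ∀ x ∈ dom, H x ∈ dom)
    (Cop : E →L[ℂ] E)
    (hCop : ∀ ψ : dom, Cop (ψ : E) = Dop ⟨H ψ, hpres _ ψ.2⟩ - H (Dop ψ))
    (f : SchwartzMap ℝ ℝ) :
    ∀ ψ : dom, ∃ hmem : cfc (fun x : ℝ => f x) H (ψ : E) ∈ dom,
      ‖Dop ⟨cfc (fun x : ℝ => f x) H (ψ : E), hmem⟩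
          - cfc (fun x : ℝ => f x) H (Dop ψ)‖ ≤
        (2 * Real.pi)⁻¹
          * (∫ t : ℝ, ‖∫ x : ℝ, Complex.exp (-(Complex.I * t * x)) * ((deriv (f : ℝ → ℝ) x : ℝ) : ℂ)‖)
          * ‖Cop‖ * ‖(ψ : E)‖ := by
  intro ψ
  obtain ⟨hmem, hle⟩ := exists_integral_propagator_mem_and_norm_le hsymm hmax hH hpres hCop
    (continuous_fourierWeight f) (integrable_sq_mul_norm_fourierWeight f) ψ
  simp only [abs_mul_norm_fourierWeight, integral_const_mul,
    ← cfc_schwartzMap_apply hH] at hmem hle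
  exact ⟨hmem, hle⟩
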